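/- Let m ≥ 3 be an integer. Then D2 has an orthonormal basis v^(1),…,v^(m−1) (orthonormal with respect to ⟨x,y⟩ = Σ_{1≤i<j≤m} x_{ij} y_{ij}) such that v^(p)_{ij} ≠ 0 for every 1 ≤ p ≤ m−1 and every 1 ≤ i ≠ j ≤ m. -/

import Mathlib

/-- The inner product on `W_m`: `⟨x, y⟩ = ∑_{i < j} x i j * y i j`. -/
def innerW (m : ℕ) (x y : Fin m → Fin m → ℝ) : ℝ :=
  ∑ i : Fin m, ∑ j : Fin m, if i < j then x i j * y i j else 0

/-- The subspace `D2` of `W_m`: antisymmetric arrays satisfying the cocycle equations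
`x i j + x j k + x k i = 0` for all `i < j < k`. -/
def D2 (m : ℕ) : Submodule ℝ (Fin m → Fin m → ℝ) where
  carrier := {x | (∀ i j : Fin m, x i j = - x j i) ∧
    ∀ i j k : Fin m, i < j → j < k → x i j + x j k + x k i = 0}
  add_mem' := by
    rintro a b ⟨ha1, ha2⟩ ⟨hb1, hb2⟩
    refine ⟨fun i j => ?_, fun i j k h1 h2 => ?_⟩
    · simp only [Pi.add_apply]
      linear_combination ha1 i j + hb1 i j
    · simp only [Pi.add_apply]
      linear_combination ha2 i j k h1 h2 + hb2 i j k h1 h2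
  zero_mem' := ⟨fun i j => by simp, fun i j k _ _ => by simp⟩
  smul_mem' := by
    rintro c a ⟨ha1, ha2⟩
    refine ⟨fun i j => ?_, fun i j k h1 h2 => ?_⟩
    · simp only [Pi.smul_apply, smul_eq_mul]
      linear_combination c * ha1 i j
    · simp only [Pi.smul_apply, smul_eq_mul]
      linear_combination c * ha2 i j k h1 h2

open Module Submodule in
/-- Given finitely many nonzero vectors in a finite-dimensional real inner product space, some
orthonormal basis has no element orthogonal to any of them. -/
theorem exists_orthonormalBasis_forall_inner_ne_zero {ι : Type*} [Finite ι] (n : ℕ)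
    {E : Type*} [NormedAddCommGroup E] [InnerProductSpace ℝ E] [FiniteDimensional ℝ E]
    (hn : finrank ℝ E = n) (w : ι → E) (hw : ∀ i, w i ≠ 0) :
    ∃ b : OrthonormalBasis (Fin n) ℝ E, ∀ p i, inner ℝ (b p) (w i) ≠ 0 := by
  suffices H : ∃ v : Fin n → E, Orthonormal ℝ v ∧ ∀ p i, inner ℝ (v p) (w i) ≠ 0 by
    obtain ⟨v, hv, h⟩ := H
    have hspan : ⊤ ≤ span ℝ (Set.range v) :=
      (hv.linearIndependent.span_eq_top_of_card_eq_finrank' (by simp [hn])).ge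
    exact ⟨OrthonormalBasis.mk hv hspan, by simpa using h⟩
  induction n generalizing E with
  | zero => exact ⟨Fin.elim0, Orthonormal.of_isEmpty _, fun p => p.elim0⟩
  | succ n ih =>
    have : Nontrivial E := finrank_pos_iff (R := ℝ).mp (by omega)
    obtain ⟨x, hx⟩ := exists_forall_notMem_of_forall_ne_top
      (fun o : Option (ι ⊕ ι) => o.elim (⊥ : Submodule ℝ E) (Sum.elim (fun i => (ℝ ∙ w i)ᗮ)
        (fun i => if n = 0 then ⊥ else ℝ ∙ w i))) (by
        rintro (_ | i | i)
        · exact bot_ne_top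
        · intro htop
          have : w i ∈ (ℝ ∙ w i)ᗮ := by
            change (ℝ ∙ w i)ᗮ = ⊤ at htop
            exact htop ▸ mem_top
          rw [mem_orthogonal_singleton_iff_inner_right] at this
          exact hw i (inner_self_eq_zero.mp this)
        · rcases eq_or_ne n 0 with h | h
          · simp [h]
          · intro htop
            simp only [Option.elim_some, Sum.elim_inr, h, if_false] at htop
            have := finrank_span_singleton (K := ℝ) (hw i)
            rw [htop, finrank_top] at this
            omega)
    have hx0 : x ≠ 0 := by simpa using hx none
    have hnorm : ‖(‖x‖⁻¹ : ℝ) • x‖ = 1 := by simp [norm_smul, hx0]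
    have hxw (i : ι) : inner ℝ x (w i) ≠ 0 := by
      simpa [mem_orthogonal_singleton_iff_inner_left] using hx (some (.inl i))
    have he (i : ι) : inner ℝ ((‖x‖⁻¹ : ℝ) • x) (w i) ≠ 0 := by
      simp [inner_smul_left, hx0, hxw i]
    rcases eq_or_ne n 0 with rfl | h
    · exact ⟨![(‖x‖⁻¹ : ℝ) • x], orthonormal_vecCons_iff.mpr
        ⟨hnorm, fun p => p.elim0, Orthonormal.of_isEmpty _⟩, by simpa using he⟩
    have hxspan (i : ι) : x ∉ ℝ ∙ w i := by simpa [h] using hx (some (.inr i))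
    have : Fact (finrank ℝ E = n + 1) := ⟨hn⟩
    obtain ⟨v, hv, hvw⟩ := ih (finrank_orthogonal_span_singleton hx0)
      (fun i => (ℝ ∙ x)ᗮ.orthogonalProjectionOnto (w i)) (fun i h0 => by
        rw [orthogonalProjectionOnto_eq_zero_iff, orthogonal_orthogonal, mem_span_singleton] at h0
        obtain ⟨c, hc⟩ := h0
        have hc0 : c ≠ 0 := by
          rintro rfl
          exact hw i (by simpa using hc.symm)
        exact hxspan i (mem_span_singleton.mpr ⟨c⁻¹, by rw [← hc, inv_smul_smul₀ hc0]⟩))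
    refine ⟨Matrix.vecCons ((‖x‖⁻¹ : ℝ) • x) (fun p => (v p : E)), ?_, ?_⟩
    · refine orthonormal_vecCons_iff.mpr ⟨hnorm, fun p => ?_,
        hv.comp_linearIsometry (ℝ ∙ x)ᗮ.subtypeₗᵢ⟩
      rw [inner_smul_left, mem_orthogonal_singleton_iff_inner_right.mp (v p).2, mul_zero]
    · refine Fin.cases he fun p i => ?_
      simpa using hvw p i

theorem sum_antisymm_eq_two_mul_innerW (m : ℕ) (x y : Fin m → Fin m → ℝ)
    (hx : ∀ i j, x i j = -x j i) (hy : ∀ i j, y i j = -y j i) :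
    ∑ i, ∑ j, x i j * y i j = 2 * innerW m x y := by
  have hswap : innerW m x y = ∑ i, ∑ j, if j < i then x i j * y i j else 0 := by
    rw [innerW, Finset.sum_comm]
    refine Finset.sum_congr rfl fun i _ => Finset.sum_congr rfl fun j _ => ?_
    rw [hx j i, hy j i, neg_mul_neg]
  rw [two_mul]
  nth_rewrite 2 [hswap]
  simp only [innerW, ← Finset.sum_add_distrib]
  refine Finset.sum_congr rfl fun i _ => Finset.sum_congr rfl fun j _ => ?_
  rcases lt_trichotomy i j with h | rfl | h
  · simp [h, h.not_gt]
  · have : x i i = 0 := by linarith [hx i i]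
    simp [this]
  · simp [h, h.not_gt]

/-- On differences of coordinates of vectors with zero sum, `innerW` is `m` times the usual
inner product. -/
theorem innerW_sub_sub (m : ℕ) (a b : Fin m → ℝ) (ha : ∑ i, a i = 0) :
    innerW m (fun i j => a i - a j) (fun i j => b i - b j) = m * ∑ i, a i * b i := by
  have h := sum_antisymm_eq_two_mul_innerW m (fun i j => a i - a j) (fun i j => b i - b j)
    (fun i j => by ring) (fun i j => by ring)
  have hexp : ∑ i, ∑ j, (a i - a j) * (b i - b j) = 2 * (m * ∑ i, a i * b i) := by
    simp only [sub_mul, mul_sub, Finset.sum_sub_distrib, ← Finset.mul_sum, ← Finset.sum_mul, ha,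
      Finset.sum_const, Finset.card_univ, Fintype.card_fin, nsmul_eq_mul, mul_left_comm _ (m : ℝ)]
    ring
  linarith

theorem add_add_eq_zero_of_mem_D2 {m : ℕ} {x : Fin m → Fin m → ℝ} (hx : x ∈ D2 m)
    (i j k : Fin m) : x i j + x j k + x k i = 0 := by
  obtain ⟨h1, h2⟩ := hx
  have a1 := h1 i j
  have a2 := h1 j k
  have a3 := h1 k i
  rcases lt_trichotomy i j with hij | rfl | hij
  · rcases lt_trichotomy j k with hjk | rfl | hjk
    · exact h2 i j k hij hjk
    · linarith
    · rcases lt_trichotomy i k with hik | rfl | hik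
      · linarith [h2 i k j hik hjk]
      · linarith
      · linarith [h2 k i j hik hij]
  · linarith
  · rcases lt_trichotomy j k with hjk | rfl | hjk
    · rcases lt_trichotomy i k with hik | rfl | hik
      · linarith [h2 j i k hij hik]
      · linarith
      · linarith [h2 j k i hjk hik]
    · linarith
    · linarith [h2 k j i hjk hij]

theorem sub_mem_D2 (m : ℕ) (a : Fin m → ℝ) : (fun i j => a i - a j) ∈ D2 m :=
  ⟨fun i j => by ring, fun i j k _ _ => by ring⟩

/-- Every element of `D2 m` is a difference array of a vector with zero sum. -/
theorem exists_eq_sub_of_mem_D2 {m : ℕ} (hm : m ≠ 0) {x : Fin m → Fin m → ℝ} (hx : x ∈ D2 m) :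
    ∃ a : Fin m → ℝ, ∑ i, a i = 0 ∧ x = fun i j => a i - a j := by
  have hm' : (m : ℝ) ≠ 0 := Nat.cast_ne_zero.mpr hm
  refine ⟨fun i => (m : ℝ)⁻¹ * ∑ k, x i k, ?_, ?_⟩
  · have h : ∑ i, ∑ k, x i k = -∑ i, ∑ k, x i k := by
      conv_lhs => rw [Finset.sum_comm]
      simp only [← Finset.sum_neg_distrib]
      exact Finset.sum_congr rfl fun i _ => Finset.sum_congr rfl fun k _ => hx.1 k i
    rw [← Finset.mul_sum, self_eq_neg.mp h, mul_zero]
  · funext i j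
    have h : ∑ k, x i k - ∑ k, x j k = m * x i j := by
      rw [← Finset.sum_sub_distrib, Finset.sum_congr rfl (g := fun _ => x i j)]
      · simp
      · intro k _
        linarith [add_add_eq_zero_of_mem_D2 hx i j k, hx.1 i k]
    rw [← mul_sub, h, inv_mul_cancel_left₀ hm']

/-- **Lemma 55, second assertion.** For `m ≥ 3`, `D2` has an orthonormal basis
`v 0, …, v (m - 2)` (orthonormal with respect to `⟨x, y⟩ = ∑_{i < j} x i j * y i j`)
all of whose components are nonzero. -/
theorem D2_orthonormal_basis_nonvanishing (m : ℕ) (hm : 3 ≤ m) :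
    ∃ v : Fin (m - 1) → (Fin m → Fin m → ℝ),
      (∀ p, v p ∈ D2 m) ∧
      (∀ p q : Fin (m - 1), innerW m (v p) (v q) = if p = q then 1 else 0) ∧
      (∀ p : Fin (m - 1), ∀ i j : Fin m, i ≠ j → v p i j ≠ 0) ∧
      Submodule.span ℝ (Set.range v) = D2 m := by
  have hm0 : m ≠ 0 := by omega
  have hmpos : (0 : ℝ) < m := by positivity
  let u : EuclideanSpace ℝ (Fin m) := WithLp.toLp 2 fun _ => 1
  have hu : u ≠ 0 := fun h => by
    have := congrArg (fun y : EuclideanSpace ℝ (Fin m) => y ⟨0, by omega⟩) h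
    simp [u] at this
  have mem_iff (y : EuclideanSpace ℝ (Fin m)) : y ∈ (Submodule.span ℝ {u})ᗮ ↔ ∑ i, y i = 0 := by
    simp [Submodule.mem_orthogonal_singleton_iff_inner_right, PiLp.inner_apply, u]
  have : Fact (Module.finrank ℝ (EuclideanSpace ℝ (Fin m)) = m - 1 + 1) := ⟨by simp; omega⟩
  let w (t : {t : Fin m × Fin m // t.1 ≠ t.2}) : (Submodule.span ℝ {u})ᗮ :=
    ⟨EuclideanSpace.single t.1.1 1 - EuclideanSpace.single t.1.2 1, by
      rw [mem_iff]; simp [Finset.sum_sub_distrib]⟩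
  obtain ⟨b, hb⟩ := exists_orthonormalBasis_forall_inner_ne_zero (m - 1)
    (Submodule.finrank_orthogonal_span_singleton hu) w (fun t h => by
      have h1 := congrArg (fun y : (Submodule.span ℝ {u})ᗮ => y.1 t.1.1) h
      simp [w, t.2] at h1)
  have hsqrt : √(m : ℝ) ≠ 0 := (Real.sqrt_pos.mpr hmpos).ne'
  have hsum (p : Fin (m - 1)) : ∑ i, (b p).1 i = 0 := (mem_iff _).mp (b p).2
  refine ⟨fun p i j => (√(m : ℝ))⁻¹ * (b p).1 i - (√(m : ℝ))⁻¹ * (b p).1 j,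
    fun p => sub_mem_D2 m _, fun p q => ?_, fun p i j hij => ?_, le_antisymm ?_ fun x hx => ?_⟩
  · rw [innerW_sub_sub m _ _ (by rw [← Finset.mul_sum, hsum, mul_zero]),
      ← orthonormal_iff_ite.mp b.orthonormal p q, Submodule.coe_inner, PiLp.inner_apply,
      Finset.mul_sum]
    refine Finset.sum_congr rfl fun i _ => ?_
    simp only [RCLike.inner_apply, conj_trivial]
    field_simp
    rw [Real.sq_sqrt hmpos.le]
  · beta_reduce
    rw [← mul_sub]
    refine mul_ne_zero (inv_ne_zero hsqrt) ?_
    simpa [w, inner_sub_right, EuclideanSpace.inner_single_right] using hb p ⟨(i, j), hij⟩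
  · rw [Submodule.span_le]
    rintro _ ⟨p, rfl⟩
    exact sub_mem_D2 m _
  · obtain ⟨a, ha, rfl⟩ := exists_eq_sub_of_mem_D2 hm0 hx
    let y : (Submodule.span ℝ {u})ᗮ := ⟨WithLp.toLp 2 a, (mem_iff _).mpr ha⟩
    have hy (i : Fin m) : a i = ∑ p, b.repr y p * (b p).1 i := by
      have := congrArg (fun z : (Submodule.span ℝ {u})ᗮ => z.1 i) (b.sum_repr y)
      simpa [y] using this.symm
    have key : (fun i j => a i - a j) = ∑ p, (√(m : ℝ) * b.repr y p) •
        fun i j => (√(m : ℝ))⁻¹ * (b p).1 i - (√(m : ℝ))⁻¹ * (b p).1 j := by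
      funext i j
      simp only [Finset.sum_apply, Pi.smul_apply, smul_eq_mul]
      rw [hy i, hy j, ← Finset.sum_sub_distrib]
      refine Finset.sum_congr rfl fun p _ => ?_
      field_simp
    rw [key]
    exact Submodule.sum_mem _ fun p _ =>
      Submodule.smul_mem _ _ (Submodule.subset_span ⟨p, rfl⟩)
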